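/- arXiv:1105.3495 — 5 statements merged into one kernel-verified Lean document; each statement's English description precedes it below -/
import Mathlib

section
/- Let N_0(B) be the number of tuples (η1,...,η10) ∈ T(B) with |η9| = |η10|. Then there is an absolute constant C such that for all B ≥ 2, N_0(B) ≤ C · B · log(B)^4. -/
open Real

noncomputable section

/-- The set `T(B)` of points on the universal torsor: here `η i` for `i = 0, ..., 9`
corresponds to `η_{i+1}` in the paper. -/
def torsorSet (B : ℝ) : Set (Fin 10 → ℤ) :=
  {η | (∀ i : Fin 10, (i : ℕ) < 7 → 0 < η i) ∧
    η 7 ≠ 0 ∧ η 8 ≠ 0 ∧ η 9 ≠ 0 ∧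
    η 0 * η 5 * η 7 + η 2 * η 4 * η 6 ^ 2 + η 8 * η 9 = 0 ∧
    Int.gcd (η 8) (η 0 * η 1 * η 2 * η 4 * η 5 * η 6 * η 7) = 1 ∧
    Int.gcd (η 0) (η 1 * η 2 * η 3 * η 4 * η 6 * η 9) = 1 ∧
    Int.gcd (η 5) (η 1 * η 2 * η 4 * η 6 * η 9) = 1 ∧
    Int.gcd (η 7) (η 2 * η 3 * η 4 * η 5 * η 6 * η 9) = 1 ∧
    Int.gcd (η 6) (η 1 * η 3 * η 9) = 1 ∧
    Int.gcd (η 1 * η 2) (η 3 * η 4) = 1 ∧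
    Int.gcd (η 9) (η 2 * η 3 * η 4) = 1 ∧
    ((η 0 * η 3 ^ 2 * η 4 * η 5 ^ 2 * |η 8| : ℤ) : ℝ) ≤ B ∧
    ((η 1 * η 2 ^ 2 * η 3 * η 4 ^ 2 * η 6 ^ 3 : ℤ) : ℝ) ≤ B ∧
    ((η 0 * η 1 ^ 2 * η 2 * η 7 ^ 2 * |η 9| : ℤ) : ℝ) ≤ B ∧
    ((η 0 * η 1 * η 2 * η 3 * η 4 * η 5 * η 6 * |η 7| : ℤ) : ℝ) ≤ B}

/-- The divisor bound `d(n) ≪ n ^ ε`. -/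
theorem exists_card_divisors_le_rpow {ε : ℝ} (hε : 0 < ε) :
    ∃ C : ℝ, 0 ≤ C ∧ ∀ n : ℕ, (n.divisors.card : ℝ) ≤ C * (n : ℝ) ^ ε := by
  obtain ⟨N, hN⟩ := exists_nat_ge ((2 : ℝ) ^ (1 / ε))
  have hlog : 0 < ε * Real.log 2 := mul_pos hε (Real.log_pos one_lt_two)
  set K : ℝ := max 1 (1 / (ε * Real.log 2)) with hK
  have hK1 : 1 ≤ K := le_max_left _ _
  have hK2 : 1 ≤ K * (ε * Real.log 2) := by
    rw [← div_le_iff₀ hlog]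
    exact le_max_right _ _
  have hK0 : 0 ≤ K := zero_le_one.trans hK1
  have small (p k : ℕ) (hp : 2 ≤ p) : ((k : ℝ) + 1) ≤ K * ((p : ℝ) ^ k) ^ ε := by
    have h1 : (1 : ℝ) + k * (ε * Real.log 2) ≤ ((p : ℝ) ^ k) ^ ε := by
      calc (1 : ℝ) + k * (ε * Real.log 2) ≤ Real.exp (k * (ε * Real.log 2)) := by
            linarith [Real.add_one_le_exp ((k : ℝ) * (ε * Real.log 2))]
        _ = ((2 : ℝ) ^ k) ^ ε := by
            rw [Real.rpow_def_of_pos (by positivity), Real.log_pow]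
            ring_nf
        _ ≤ ((p : ℝ) ^ k) ^ ε := by
            gcongr
            exact_mod_cast hp
    have h2 : (k : ℝ) ≤ k * (K * (ε * Real.log 2)) :=
      le_mul_of_one_le_right (Nat.cast_nonneg k) hK2
    calc (k : ℝ) + 1 ≤ K * (1 + k * (ε * Real.log 2)) := by linarith
      _ ≤ _ := by gcongr
  have large (p k : ℕ) (hp : N ≤ p) : ((k : ℝ) + 1) ≤ ((p : ℝ) ^ k) ^ ε := by
    have h1 : (2 : ℝ) ≤ (p : ℝ) ^ ε := by
      calc (2 : ℝ) = ((2 : ℝ) ^ (1 / ε)) ^ ε := by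
            rw [← Real.rpow_mul zero_le_two, one_div_mul_cancel hε.ne', Real.rpow_one]
        _ ≤ (p : ℝ) ^ ε := by
            gcongr
            exact hN.trans (by exact_mod_cast hp)
    have h2 : k + 1 ≤ 2 ^ k := Nat.lt_two_pow_self
    calc (k : ℝ) + 1 ≤ 2 ^ k := by exact_mod_cast h2
      _ ≤ ((p : ℝ) ^ ε) ^ k := by gcongr
      _ = ((p : ℝ) ^ k) ^ ε := by
        rw [← Real.rpow_natCast, ← Real.rpow_natCast, ← Real.rpow_mul (Nat.cast_nonneg p),
          ← Real.rpow_mul (Nat.cast_nonneg p), mul_comm]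
  refine ⟨K ^ N, by positivity, fun n => ?_⟩
  rcases eq_or_ne n 0 with rfl | hn
  · simp only [Nat.divisors_zero, Finset.card_empty, Nat.cast_zero]
    positivity
  have hpow : (n : ℝ) ^ ε = ∏ p ∈ n.primeFactors, ((p : ℝ) ^ n.factorization p) ^ ε := by
    rw [Real.finsetProd_rpow _ _ (fun _ _ => by positivity)]
    congr 1
    conv_lhs => rw [← Nat.prod_factorization_pow_eq_self hn]
    simp [Finsupp.prod]
  have hcount : ∏ p ∈ n.primeFactors, (if p < N then K else 1) ≤ K ^ N := by
    rw [← Finset.prod_filter, Finset.prod_const]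
    refine pow_le_pow_right₀ hK1 ?_
    calc (n.primeFactors.filter (· < N)).card ≤ (Finset.range N).card :=
          Finset.card_le_card fun p hp => by simpa using (Finset.mem_filter.1 hp).2
      _ = N := Finset.card_range N
  rw [Nat.card_divisors hn]
  push_cast
  calc ∏ p ∈ n.primeFactors, ((n.factorization p : ℝ) + 1)
      ≤ ∏ p ∈ n.primeFactors, ((if p < N then K else 1) * ((p : ℝ) ^ n.factorization p) ^ ε) := by
        refine Finset.prod_le_prod (fun _ _ => by positivity) fun p hp => ?_
        split_ifs with h
        · exact small p _ (Nat.prime_of_mem_primeFactors hp).two_le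
        · rw [one_mul]
          exact large p _ (not_lt.1 h)
    _ = (∏ p ∈ n.primeFactors, (if p < N then K else 1)) * (n : ℝ) ^ ε := by
        rw [Finset.prod_mul_distrib, hpow]
    _ ≤ K ^ N * (n : ℝ) ^ ε := by gcongr

theorem exists_sum_Icc_rpow_le {p : ℝ} (hp : p < -1) :
    ∃ C : ℝ, 0 ≤ C ∧ ∀ R : ℕ, ∑ k ∈ Finset.Icc 1 R, (k : ℝ) ^ p ≤ C :=
  ⟨∑' k : ℕ, (k : ℝ) ^ p, tsum_nonneg fun _ => by positivity, fun _ =>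
    (Real.summable_nat_rpow.2 hp).sum_le_tsum _ fun _ _ => by positivity⟩

/-- Combines the bound for `t = η2 * η4` coming from the second height condition with the one
coming from the product of the first and the third height condition. -/
theorem pow_four_mul_le {t m g w n B : ℝ} (ht : 0 ≤ t) (hm : 0 ≤ m) (hg : 0 ≤ g)
    (hn : w ^ 2 - m * g ^ 2 ≤ n) (h₁ : t * m ^ 2 * g ^ 3 ≤ B)
    (h₂ : t ^ 2 * n ^ 2 * w ^ 2 * m ≤ B ^ 2) :
    t ^ 4 * m ^ 5 * g ^ 6 * w ^ 6 ≤ 64 * B ^ 4 := by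
  set V := m * g ^ 2 with hV
  set W := w ^ 2 with hW
  have hV0 : 0 ≤ V := by positivity
  have hW0 : 0 ≤ W := by positivity
  have hrw : t ^ 4 * m ^ 5 * g ^ 6 * w ^ 6 = t ^ 4 * m ^ 2 * (V ^ 3 * W ^ 3) := by
    rw [hV, hW]
    ring
  have hB4 : 0 ≤ B ^ 4 := by positivity
  rw [hrw]
  rcases le_or_gt W (4 * V) with h | h
  · calc t ^ 4 * m ^ 2 * (V ^ 3 * W ^ 3) ≤ t ^ 4 * m ^ 2 * (V ^ 3 * (4 * V) ^ 3) := by gcongr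
      _ = 64 * (t * m ^ 2 * g ^ 3) ^ 4 := by
        rw [hV]
        ring
      _ ≤ 64 * B ^ 4 := by gcongr
  · have hn' : 3 / 4 * W ≤ n := by linarith
    have hV' : V ≤ 1 / 4 * W := by linarith
    have hsq : (t ^ 2 * n ^ 2 * W * m) ^ 2 ≤ (B ^ 2) ^ 2 := by
      have hn0 : 0 ≤ n := by linarith
      gcongr
    calc t ^ 4 * m ^ 2 * (V ^ 3 * W ^ 3) ≤ t ^ 4 * m ^ 2 * ((1 / 4 * W) ^ 3 * W ^ 3) := by gcongr
      _ ≤ 64 * (t ^ 4 * m ^ 2 * ((3 / 4 * W) ^ 4 * W ^ 2)) := by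
        have : 0 ≤ t ^ 4 * m ^ 2 * W ^ 6 := by positivity
        linarith
      _ ≤ 64 * (t ^ 4 * m ^ 2 * (n ^ 4 * W ^ 2)) := by gcongr
      _ = 64 * (t ^ 2 * n ^ 2 * W * m) ^ 2 := by ring
      _ ≤ 64 * B ^ 4 := by linarith

/-- The bound of `pow_four_mul_le` with its fourth root taken. -/
theorem mul_rpow_le {t c e g w n B : ℝ} (ht : 0 ≤ t) (hc : 0 ≤ c) (he : 0 ≤ e) (hg : 0 ≤ g)
    (hw : 0 ≤ w) (hB : 0 ≤ B) (hn : w ^ 2 - c * e * g ^ 2 ≤ n)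
    (h₁ : t * (c * e) ^ 2 * g ^ 3 ≤ B) (h₂ : t ^ 2 * n ^ 2 * w ^ 2 * (c * e) ≤ B ^ 2) :
    t * (c ^ (5 / 4 : ℝ) * e ^ (5 / 4 : ℝ) * g ^ (3 / 2 : ℝ) * w ^ (3 / 2 : ℝ)) ≤ 3 * B := by
  have h := pow_four_mul_le ht (mul_nonneg hc he) hg hn h₁ h₂
  have h5 (x : ℝ) (hx : 0 ≤ x) : (x ^ (5 / 4 : ℝ)) ^ 4 = x ^ 5 := by
    rw [← Real.rpow_natCast, ← Real.rpow_natCast, ← Real.rpow_mul hx]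
    norm_num
  have h6 (x : ℝ) (hx : 0 ≤ x) : (x ^ (3 / 2 : ℝ)) ^ 4 = x ^ 6 := by
    rw [← Real.rpow_natCast, ← Real.rpow_natCast, ← Real.rpow_mul hx]
    norm_num
  refine le_of_pow_le_pow_left₀ four_ne_zero (by positivity) ?_
  simp only [mul_pow, h5 c hc, h5 e he, h6 g hg, h6 w hw] at h ⊢
  have : 0 ≤ B ^ 4 := by positivity
  linarith

/-- `|η1 * η6 * η8|` in terms of `c = η3`, `e = η5`, `g = η7`, `w = |η9| = |η10|` and the signs
`x`, `y` of `η9`, `η10`. -/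
def residualProduct (c e g w : ℕ) (x y : ℤ) : ℕ :=
  (c * e * g ^ 2 + x * y * w ^ 2 : ℤ).natAbs

/-- An upper bound for `η4`, given `η3`, `η5`, `η7`, `|η9|` and `η2`. -/
def etaFourBound (B : ℝ) (c e g w b : ℕ) : ℝ :=
  3 * B / ((c : ℝ) ^ (5 / 4 : ℝ) * (e : ℝ) ^ (5 / 4 : ℝ) * (g : ℝ) ^ (3 / 2 : ℝ) *
    (w : ℝ) ^ (3 / 2 : ℝ)) / b

theorem le_etaFourBound {B : ℝ} {c e g w b d : ℕ} {n : ℝ} (hc : 0 < c) (he : 0 < e) (hg : 0 < g)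
    (hw : 0 < w) (hb : 0 < b) (hB : 0 ≤ B)
    (hn : (w : ℝ) ^ 2 - c * e * g ^ 2 ≤ n)
    (h₁ : (b * d : ℝ) * (c * e) ^ 2 * g ^ 3 ≤ B)
    (h₂ : (b * d : ℝ) ^ 2 * n ^ 2 * w ^ 2 * (c * e) ≤ B ^ 2) :
    (d : ℝ) ≤ etaFourBound B c e g w b := by
  have h := mul_rpow_le (by positivity) (by positivity) (by positivity) (by positivity)
    (by positivity) hB hn h₁ h₂
  rw [etaFourBound, le_div_iff₀ (by positivity), le_div_iff₀ (by positivity)]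
  linarith

/-- Keys `(η3, η5, η7, |η9|, η2, sign η9, sign η10)`. -/
def keyBox (R : ℕ) : Finset (ℕ × ℕ × ℕ × ℕ × ℕ × ℤ × ℤ) :=
  Finset.Icc 1 R ×ˢ Finset.Icc 1 R ×ˢ Finset.Icc 1 R ×ˢ Finset.Icc 1 R ×ˢ Finset.Icc 1 R ×ˢ
    ({1, -1} : Finset ℤ) ×ˢ ({1, -1} : Finset ℤ)

/-- Candidates for `(η1, η6, η4)` over a given key. -/
def keyFibre (B : ℝ) (k : ℕ × ℕ × ℕ × ℕ × ℕ × ℤ × ℤ) : Finset (ℕ × ℕ × ℕ) :=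
  match k with
  | (c, e, g, w, b, x, y) =>
    (residualProduct c e g w x y).divisors ×ˢ (residualProduct c e g w x y).divisors ×ˢ
      Finset.Icc 1 ⌊etaFourBound B c e g w b⌋₊

/-- The coordinates of a torsor point that determine it when `|η9| = |η10|`. -/
def torsorKey (η : Fin 10 → ℤ) : Σ _ : ℕ × ℕ × ℕ × ℕ × ℕ × ℤ × ℤ, ℕ × ℕ × ℕ :=
  ⟨((η 2).natAbs, (η 4).natAbs, (η 6).natAbs, (η 8).natAbs, (η 1).natAbs,
    (η 8).sign, (η 9).sign), ((η 0).natAbs, (η 5).natAbs, (η 3).natAbs)⟩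

theorem Int.sign_mem_pair {z : ℤ} (hz : z ≠ 0) : z.sign ∈ ({1, -1} : Finset ℤ) := by
  rcases lt_or_gt_of_ne hz with h | h
  · simp [Int.sign_eq_neg_one_of_neg h]
  · simp [Int.sign_eq_one_of_pos h]

theorem injOn_torsorKey (B : ℝ) :
    Set.InjOn torsorKey {η ∈ torsorSet B | |η 8| = |η 9|} := by
  rintro η ⟨⟨hpos, -, -, -, heq, -⟩, habs⟩ θ ⟨⟨hpos', -, -, -, heq', -⟩, habs'⟩ h
  simp only [torsorKey, Sigma.mk.injEq, Prod.mk.injEq, heq_eq_eq] at h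
  obtain ⟨⟨h2, h4, h6, h8, h1, s8, s9⟩, h0, h5, h3⟩ := h
  have key (i : Fin 10) (hi : (i : ℕ) < 7) (h : (η i).natAbs = (θ i).natAbs) : η i = θ i := by
    have := hpos i hi
    have := hpos' i hi
    omega
  replace h0 := key 0 (by decide) h0
  replace h1 := key 1 (by decide) h1
  replace h2 := key 2 (by decide) h2
  replace h3 := key 3 (by decide) h3
  replace h4 := key 4 (by decide) h4
  replace h5 := key 5 (by decide) h5
  replace h6 := key 6 (by decide) h6
  have e8 : η 8 = θ 8 := by
    rw [← Int.sign_mul_natAbs (η 8), ← Int.sign_mul_natAbs (θ 8), s8, h8]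
  have e9 : η 9 = θ 9 := by
    rw [← Int.sign_mul_natAbs (η 9), ← Int.sign_mul_natAbs (θ 9), s9,
      ← Int.natAbs_eq_natAbs_iff.2 (abs_eq_abs.1 habs),
      ← Int.natAbs_eq_natAbs_iff.2 (abs_eq_abs.1 habs'), h8]
  have e7 : η 7 = θ 7 := by
    have h05 : θ 0 * θ 5 ≠ 0 := (mul_pos (hpos' 0 (by decide)) (hpos' 5 (by decide))).ne'
    rw [h0, h2, h4, h5, h6, e8, e9] at heq
    exact mul_left_cancel₀ h05 (by linarith)
  funext i
  fin_cases i <;> assumption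

theorem torsorKey_mem {B : ℝ} {η : Fin 10 → ℤ} (hη : η ∈ torsorSet B) (habs : |η 8| = |η 9|) :
    torsorKey η ∈ (keyBox ⌊B⌋₊).sigma (keyFibre B) := by
  obtain ⟨hpos, hne7, hne8, hne9, heq, -, -, -, -, -, -, -, H1, H2, H3, -⟩ := hη
  obtain ⟨a, ha⟩ := Int.eq_ofNat_of_zero_le (hpos 0 (by decide)).le
  obtain ⟨b, hb⟩ := Int.eq_ofNat_of_zero_le (hpos 1 (by decide)).le
  obtain ⟨c, hc⟩ := Int.eq_ofNat_of_zero_le (hpos 2 (by decide)).le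
  obtain ⟨d, hd⟩ := Int.eq_ofNat_of_zero_le (hpos 3 (by decide)).le
  obtain ⟨e, he⟩ := Int.eq_ofNat_of_zero_le (hpos 4 (by decide)).le
  obtain ⟨f, hf⟩ := Int.eq_ofNat_of_zero_le (hpos 5 (by decide)).le
  obtain ⟨g, hg⟩ := Int.eq_ofNat_of_zero_le (hpos 6 (by decide)).le
  have ha0 : 0 < a := by have := hpos 0 (by decide); omega
  have hb0 : 0 < b := by have := hpos 1 (by decide); omega
  have hc0 : 0 < c := by have := hpos 2 (by decide); omega
  have hd0 : 0 < d := by have := hpos 3 (by decide); omega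
  have he0 : 0 < e := by have := hpos 4 (by decide); omega
  have hf0 : 0 < f := by have := hpos 5 (by decide); omega
  have hg0 : 0 < g := by have := hpos 6 (by decide); omega
  obtain ⟨w, hw⟩ : ∃ w, w = (η 8).natAbs := ⟨_, rfl⟩
  have hw0 : 0 < w := by omega
  have hw9 : w = (η 9).natAbs := by rw [hw]; exact Int.natAbs_eq_natAbs_iff.2 (abs_eq_abs.1 habs)
  obtain ⟨h, hh⟩ : ∃ h, h = (η 7).natAbs := ⟨_, rfl⟩
  have hh0 : 0 < h := by omega
  have hprod : η 8 * η 9 = (η 8).sign * (η 9).sign * w ^ 2 := by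
    conv_lhs => rw [← Int.sign_mul_natAbs (η 8), ← Int.sign_mul_natAbs (η 9), ← hw, ← hw9]
    ring
  have hres : residualProduct c e g w (η 8).sign (η 9).sign = a * f * h := by
    have : (c * e * g ^ 2 + (η 8).sign * (η 9).sign * w ^ 2 : ℤ) = -(a * f * η 7) := by
      rw [← hprod, ← ha, ← hc, ← he, ← hf, ← hg]
      linarith
    rw [residualProduct, this, hh]
    simp [Int.natAbs_mul]
  have hw_abs : |η 8| = (w : ℤ) := by rw [hw, Int.natCast_natAbs]
  have hh_sq : (η 7) ^ 2 = (h : ℤ) ^ 2 := by rw [hh, Int.natCast_natAbs, sq_abs]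
  rw [ha, hd, he, hf, hw_abs] at H1
  rw [hb, hc, hd, he, hg] at H2
  rw [ha, hb, hc, hh_sq, ← habs, hw_abs] at H3
  norm_cast at H1 H2 H3
  have hN1 := Nat.le_floor H1
  have hN2 := Nat.le_floor H2
  have hbR : b ≤ ⌊B⌋₊ := (Nat.le_mul_of_pos_right b (by positivity :
    0 < c ^ 2 * d * e ^ 2 * g ^ 3)).trans (by linarith)
  have hcR : c ≤ ⌊B⌋₊ := (Nat.le_mul_of_pos_right c (by positivity :
    0 < b * c * d * e ^ 2 * g ^ 3)).trans (by linarith)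
  have heR : e ≤ ⌊B⌋₊ := (Nat.le_mul_of_pos_right e (by positivity :
    0 < b * c ^ 2 * d * e * g ^ 3)).trans (by linarith)
  have hgR : g ≤ ⌊B⌋₊ := (Nat.le_mul_of_pos_right g (by positivity :
    0 < b * c ^ 2 * d * e ^ 2 * g ^ 2)).trans (by linarith)
  have hwR : w ≤ ⌊B⌋₊ := (Nat.le_mul_of_pos_right w (by positivity :
    0 < a * d ^ 2 * e * f ^ 2)).trans (by linarith)
  have hB0 : 0 ≤ B := (Nat.cast_nonneg _).trans H1
  have hn : (w : ℝ) ^ 2 - c * e * g ^ 2 ≤ ((a * f * h : ℕ) : ℝ) := by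
    have hss : (w : ℤ) ^ 2 = |(η 8).sign * (η 9).sign * (w : ℤ) ^ 2| := by
      rw [← hprod, abs_mul, ← habs, hw_abs, sq]
    have hcast : ((a * f * h : ℕ) : ℤ) =
        |(c * e * g ^ 2 + (η 8).sign * (η 9).sign * w ^ 2 : ℤ)| := by
      rw [← hres, residualProduct, Int.natCast_natAbs]
    have hz : (w : ℤ) ^ 2 - c * e * g ^ 2 ≤ ((a * f * h : ℕ) : ℤ) := by
      rw [hcast]
      have h1 := abs_sub_abs_le_abs_sub ((η 8).sign * (η 9).sign * (w : ℤ) ^ 2)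
        (-(c * e * g ^ 2 : ℤ))
      rw [abs_neg, abs_of_nonneg (by positivity : (0 : ℤ) ≤ c * e * g ^ 2)] at h1
      rwa [sub_neg_eq_add, add_comm (_ * _ : ℤ) (c * e * g ^ 2 : ℤ), ← hss] at h1
    exact_mod_cast hz
  have hdle : (d : ℝ) ≤ etaFourBound B c e g w b := by
    refine le_etaFourBound hc0 he0 hg0 hw0 hb0 hB0 hn ?_ ?_
    · push_cast at H2
      linarith
    · push_cast at H1 H3 ⊢
      calc (b * d : ℝ) ^ 2 * (a * f * h) ^ 2 * w ^ 2 * (c * e)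
          = (a * d ^ 2 * e * f ^ 2 * w) * (a * b ^ 2 * c * h ^ 2 * w) := by ring
        _ ≤ B * B := by gcongr
        _ = B ^ 2 := (sq B).symm
  simp only [torsorKey, keyBox, keyFibre, Finset.mem_sigma, Finset.mem_product, Finset.mem_Icc,
    Nat.mem_divisors, ha, hb, hc, hd, he, hf, hg, Int.natAbs_natCast, ← hw, hres]
  have hne : a * f * h ≠ 0 := by positivity
  exact ⟨⟨⟨hc0, hcR⟩, ⟨he0, heR⟩, ⟨hg0, hgR⟩, ⟨hw0, hwR⟩, ⟨hb0, hbR⟩, Int.sign_mem_pair hne8,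
    Int.sign_mem_pair hne9⟩, ⟨⟨f * h, by ring⟩, hne⟩, ⟨⟨a * h, by ring⟩, hne⟩, hd0,
    Nat.le_floor hdle⟩

theorem residualProduct_le {c e g w : ℕ} {x y : ℤ} (hc : 0 < c) (he : 0 < e) (hg : 0 < g)
    (hw : 0 < w) (hx : x ∈ ({1, -1} : Finset ℤ)) (hy : y ∈ ({1, -1} : Finset ℤ)) :
    residualProduct c e g w x y ≤ 2 * (c * e * g ^ 2 * w ^ 2) := by
  have hxy : (x * y).natAbs = 1 := by
    simp only [Finset.mem_insert, Finset.mem_singleton] at hx hy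
    rcases hx with rfl | rfl <;> rcases hy with rfl | rfl <;> rfl
  have h1 : residualProduct c e g w x y ≤ c * e * g ^ 2 + w ^ 2 := by
    refine (Int.natAbs_add_le _ _).trans (le_of_eq ?_)
    rw [Int.natAbs_mul (x * y), hxy, one_mul]
    simp [Int.natAbs_mul, Int.natAbs_pow]
  have hA : 1 ≤ c * e * g ^ 2 := Nat.one_le_iff_ne_zero.2 (by positivity)
  have hW : 1 ≤ w ^ 2 := Nat.one_le_iff_ne_zero.2 (by positivity)
  nlinarith

theorem card_keyFibre_le {C : ℝ} (hC0 : 0 ≤ C)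
    (hC : ∀ n : ℕ, (n.divisors.card : ℝ) ≤ C * (n : ℝ) ^ (1 / 16 : ℝ)) {B : ℝ} (hB : 0 ≤ B)
    {c e g w b : ℕ} {x y : ℤ} (hc : 0 < c) (he : 0 < e) (hg : 0 < g) (hw : 0 < w)
    (hx : x ∈ ({1, -1} : Finset ℤ)) (hy : y ∈ ({1, -1} : Finset ℤ)) :
    ((keyFibre B (c, e, g, w, b, x, y)).card : ℝ) ≤
      6 * C ^ 2 * B * ((c : ℝ) ^ (-9 / 8 : ℝ) * ((e : ℝ) ^ (-9 / 8 : ℝ) *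
        ((g : ℝ) ^ (-5 / 4 : ℝ) * ((w : ℝ) ^ (-5 / 4 : ℝ) * (b : ℝ)⁻¹)))) := by
  have hcR : (0 : ℝ) < c := by exact_mod_cast hc
  have heR : (0 : ℝ) < e := by exact_mod_cast he
  have hgR : (0 : ℝ) < g := by exact_mod_cast hg
  have hwR : (0 : ℝ) < w := by exact_mod_cast hw
  set n := residualProduct c e g w x y with hn
  have hnle : (n : ℝ) ≤ 2 * (c * e * g ^ 2 * w ^ 2) := by
    exact_mod_cast residualProduct_le hc he hg hw hx hy
  have hdiv : (n.divisors.card : ℝ) * n.divisors.card ≤ C ^ 2 * (2 *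
      ((c : ℝ) ^ (1 / 8 : ℝ) * (e : ℝ) ^ (1 / 8 : ℝ) * (g : ℝ) ^ (1 / 4 : ℝ) *
        (w : ℝ) ^ (1 / 4 : ℝ))) := by
    calc (n.divisors.card : ℝ) * n.divisors.card
        ≤ (C * (n : ℝ) ^ (1 / 16 : ℝ)) * (C * (n : ℝ) ^ (1 / 16 : ℝ)) := by
          gcongr <;> exact hC n
      _ = C ^ 2 * (n : ℝ) ^ (1 / 8 : ℝ) := by
          have : (n : ℝ) ^ (1 / 8 : ℝ) = (n : ℝ) ^ (1 / 16 : ℝ) * (n : ℝ) ^ (1 / 16 : ℝ) := by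
            rw [← Real.rpow_add_of_nonneg (Nat.cast_nonneg n) (by norm_num) (by norm_num)]
            norm_num
          rw [this]
          ring
      _ ≤ C ^ 2 * (2 * (c * e * g ^ 2 * w ^ 2) : ℝ) ^ (1 / 8 : ℝ) := by gcongr
      _ = C ^ 2 * ((2 : ℝ) ^ (1 / 8 : ℝ) * ((c : ℝ) ^ (1 / 8 : ℝ) * (e : ℝ) ^ (1 / 8 : ℝ) *
            (g : ℝ) ^ (1 / 4 : ℝ) * (w : ℝ) ^ (1 / 4 : ℝ))) := by
          have hsq (z : ℝ) (hz : 0 ≤ z) : (z ^ 2) ^ (1 / 8 : ℝ) = z ^ (1 / 4 : ℝ) := by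
            rw [← Real.rpow_natCast, ← Real.rpow_mul hz]
            norm_num
          rw [Real.mul_rpow (by positivity) (by positivity),
            Real.mul_rpow (by positivity) (by positivity),
            Real.mul_rpow (by positivity) (by positivity),
            Real.mul_rpow (by positivity) (by positivity), hsq _ hgR.le, hsq _ hwR.le]
      _ ≤ _ := by
          gcongr
          exact Real.rpow_le_self_of_one_le one_le_two (by norm_num)
  have hbound : 0 ≤ etaFourBound B c e g w b := by
    rw [etaFourBound]
    positivity
  have h8 (z : ℝ) (hz : 0 < z) : z ^ (-9 / 8 : ℝ) = z ^ (1 / 8 : ℝ) / z ^ (5 / 4 : ℝ) := by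
    rw [← Real.rpow_sub hz]
    norm_num
  have h4 (z : ℝ) (hz : 0 < z) : z ^ (-5 / 4 : ℝ) = z ^ (1 / 4 : ℝ) / z ^ (3 / 2 : ℝ) := by
    rw [← Real.rpow_sub hz]
    norm_num
  have hcard : ((keyFibre B (c, e, g, w, b, x, y)).card : ℝ) =
      (n.divisors.card : ℝ) * n.divisors.card * ⌊etaFourBound B c e g w b⌋₊ := by
    simp only [keyFibre, Finset.card_product, Nat.card_Icc, ← hn]
    push_cast
    simp [mul_assoc]
  rw [hcard]
  calc (n.divisors.card : ℝ) * n.divisors.card * ⌊etaFourBound B c e g w b⌋₊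
      ≤ C ^ 2 * (2 * ((c : ℝ) ^ (1 / 8 : ℝ) * (e : ℝ) ^ (1 / 8 : ℝ) * (g : ℝ) ^ (1 / 4 : ℝ) *
        (w : ℝ) ^ (1 / 4 : ℝ))) * etaFourBound B c e g w b := by
        gcongr
        exact Nat.floor_le hbound
    _ = _ := by
        rw [etaFourBound, h8 _ hcR, h8 _ heR, h4 _ hgR, h4 _ hwR]
        simp only [div_eq_mul_inv, mul_inv]
        ring

theorem sum_keyBox (R : ℕ) (A : ℝ) (u v : ℝ) :
    ∑ k ∈ keyBox R, A * ((k.1 : ℝ) ^ u * ((k.2.1 : ℝ) ^ u * ((k.2.2.1 : ℝ) ^ v *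
      ((k.2.2.2.1 : ℝ) ^ v * (k.2.2.2.2.1 : ℝ)⁻¹)))) =
    4 * A * ((∑ k ∈ Finset.Icc 1 R, (k : ℝ) ^ u) ^ 2 * (∑ k ∈ Finset.Icc 1 R, (k : ℝ) ^ v) ^ 2 *
      ∑ k ∈ Finset.Icc 1 R, (k : ℝ)⁻¹) := by
  simp only [keyBox, Finset.sum_product, ← Finset.mul_sum, ← Finset.sum_mul, Finset.sum_const]
  have hsigns : (({1, -1} : Finset ℤ) ×ˢ ({1, -1} : Finset ℤ)).card = 4 := by decide
  simp only [hsigns, nsmul_eq_mul, ← Finset.mul_sum]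
  push_cast
  ring

/-- The number of torsor points with `|η9| = |η10|` is `O(B log(B)^4)`. -/
theorem diagonal_contribution :
    ∃ C : ℝ, ∀ B : ℝ, 2 ≤ B →
      (({η ∈ torsorSet B | |η 8| = |η 9|}).ncard : ℝ) ≤ C * B * Real.log B ^ 4 := by
  obtain ⟨C, hC0, hC⟩ := exists_card_divisors_le_rpow (ε := 1 / 16) (by norm_num)
  obtain ⟨S, hS0, hS⟩ := exists_sum_Icc_rpow_le (p := -9 / 8) (by norm_num)
  obtain ⟨T, hT0, hT⟩ := exists_sum_Icc_rpow_le (p := -5 / 4) (by norm_num)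
  refine ⟨4 * (6 * C ^ 2) * (S ^ 2 * T ^ 2 * 40), fun B hB => ?_⟩
  have hB0 : 0 ≤ B := by linarith
  have hcard : {η ∈ torsorSet B | |η 8| = |η 9|}.ncard ≤
      ((keyBox ⌊B⌋₊).sigma (keyFibre B)).card := by
    rw [← Set.ncard_coe_finset]
    exact Set.ncard_le_ncard_of_injOn torsorKey (fun η hη => torsorKey_mem hη.1 hη.2)
      (injOn_torsorKey B) (Finset.finite_toSet _)
  have hharm : ∑ k ∈ Finset.Icc 1 ⌊B⌋₊, (k : ℝ)⁻¹ ≤ 1 + Real.log B := by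
    have := harmonic_floor_le_one_add_log B (by linarith)
    rw [harmonic_eq_sum_Icc] at this
    push_cast at this
    exact this
  have hlog : 1 + Real.log B ≤ 40 * Real.log B ^ 4 := by
    have h1 : (1 / 2 : ℝ) ≤ Real.log B := by
      have := Real.log_le_log two_pos hB
      linarith [Real.log_two_gt_d9]
    have h2 : (1 / 2 : ℝ) ^ 3 ≤ Real.log B ^ 3 := by gcongr
    nlinarith
  calc ({η ∈ torsorSet B | |η 8| = |η 9|}.ncard : ℝ)
      ≤ ((keyBox ⌊B⌋₊).sigma (keyFibre B)).card := by exact_mod_cast hcard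
    _ = ∑ k ∈ keyBox ⌊B⌋₊, ((keyFibre B k).card : ℝ) := by
        rw [Finset.card_sigma]
        push_cast
        rfl
    _ ≤ ∑ k ∈ keyBox ⌊B⌋₊, 6 * C ^ 2 * B * ((k.1 : ℝ) ^ (-9 / 8 : ℝ) *
          ((k.2.1 : ℝ) ^ (-9 / 8 : ℝ) * ((k.2.2.1 : ℝ) ^ (-5 / 4 : ℝ) *
            ((k.2.2.2.1 : ℝ) ^ (-5 / 4 : ℝ) * (k.2.2.2.2.1 : ℝ)⁻¹)))) := by
        refine Finset.sum_le_sum fun ⟨c, e, g, w, b, x, y⟩ hk => ?_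
        simp only [keyBox, Finset.mem_product, Finset.mem_Icc] at hk
        obtain ⟨hc, he, hg, hw, -, hx, hy⟩ := hk
        exact card_keyFibre_le hC0 hC hB0 hc.1 he.1 hg.1 hw.1 hx hy
    _ = 4 * (6 * C ^ 2 * B) * ((∑ k ∈ Finset.Icc 1 ⌊B⌋₊, (k : ℝ) ^ (-9 / 8 : ℝ)) ^ 2 *
          (∑ k ∈ Finset.Icc 1 ⌊B⌋₊, (k : ℝ) ^ (-5 / 4 : ℝ)) ^ 2 *
            ∑ k ∈ Finset.Icc 1 ⌊B⌋₊, (k : ℝ)⁻¹) := sum_keyBox _ _ _ _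
    _ ≤ 4 * (6 * C ^ 2 * B) * (S ^ 2 * T ^ 2 * (40 * Real.log B ^ 4)) := by
        gcongr
        · exact hS _
        · exact hT _
        · exact hharm.trans hlog
    _ = 4 * (6 * C ^ 2) * (S ^ 2 * T ^ 2 * 40) * B * Real.log B ^ 4 := by ring

end
end

section
/- Let A ∈ ℝ, Y ≥ 1 and r a positive integer. Let R ⊂ ℝ be the set of real numbers t such that |t^r + A·t^{r−1}| ≤ Y. Then the Lebesgue measure of R is at most 4·Y^{1/r}. -/
open MeasureTheory Real

/-- Elementary lemma: the set of `t` with `|t^r + A t^(r-1)| ≤ Y` has measure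
at most `4 Y^(1/r)`. -/
theorem measure_of_poly_condition :
    ∀ (A Y : ℝ), 1 ≤ Y → ∀ r : ℕ, 1 ≤ r →
      volume {t : ℝ | |t ^ r + A * t ^ (r - 1)| ≤ Y} ≤
        ENNReal.ofReal (4 * Y ^ ((1 : ℝ) / r)) := by
  intro A Y hY r hr
  have hY0 : 0 ≤ Y := zero_le_one.trans hY
  set s := Y ^ ((1 : ℝ) / r) with hs
  have hs0 : 0 < s := by positivity
  have hsr : s ^ r = Y := by
    rw [hs, one_div, Real.rpow_inv_natCast_pow hY0 (by omega)]
  have hsub : {t : ℝ | |t ^ r + A * t ^ (r - 1)| ≤ Y} ⊆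
      Metric.closedBall 0 s ∪ Metric.closedBall (-A) s := by
    intro t ht
    by_contra hfar
    simp only [Set.mem_union, Metric.mem_closedBall, Real.dist_eq, sub_zero, sub_neg_eq_add,
      not_or, not_le] at hfar
    obtain ⟨h0, hA⟩ := hfar
    obtain ⟨n, rfl⟩ : ∃ n, r = n + 1 := ⟨r - 1, by omega⟩
    have hfactor : t ^ (n + 1) + A * t ^ n = t ^ n * (t + A) := by ring
    simp only [Set.mem_ofPred_eq, Nat.add_sub_cancel, hfactor, abs_mul, abs_pow] at ht
    have hlt : s ^ n * s < |t| ^ n * |t + A| :=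
      mul_lt_mul' (by gcongr) hA hs0.le (pow_pos (hs0.trans h0) n)
    rw [← pow_succ, hsr] at hlt
    exact absurd ht hlt.not_ge
  calc volume {t : ℝ | |t ^ r + A * t ^ (r - 1)| ≤ Y}
      ≤ volume (Metric.closedBall 0 s ∪ Metric.closedBall (-A) s) := measure_mono hsub
    _ ≤ volume (Metric.closedBall 0 s) + volume (Metric.closedBall (-A) s) :=
        measure_union_le _ _
    _ = ENNReal.ofReal (4 * s) := by
        rw [Real.volume_closedBall, Real.volume_closedBall,
          ← ENNReal.ofReal_add (by positivity) (by positivity)]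
        ring_nf
end

section
/- For all t6, t7 > 0, the one-dimensional Lebesgue measure of { t8 ∈ ℝ : h(t8, t6, t7) ≤ 1 } is at most 2/(t6·t7). Moreover, there is an absolute constant C such that for all t7 > 0, the two-dimensional Lebesgue measure of D_h(t7) = { (t8, t6) ∈ ℝ² : t6 > 0, h(t8, t6, t7) ≤ 1 } is at most C. -/
open MeasureTheory Real

noncomputable section

/-- The function `h(t8, t6, t7)`. -/
def hfun (t8 t6 t7 : ℝ) : ℝ :=
  max (max (t6 ^ 2 * |t7 ^ 2 + t6 * t8|) t7) (max |t8| (t6 * t7 * |t8|))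

/-- The region `D_h(t7)`. -/
def Dh (t7 : ℝ) : Set (ℝ × ℝ) := {p | 0 < p.2 ∧ hfun p.1 p.2 t7 ≤ 1}

/-- The part of the region with `t6 > 1`, keeping only the first constraint, has area at most `1`. -/
lemma volume_one_lt_le (a : ℝ) :
    volume {p : ℝ × ℝ | 1 < p.2 ∧ p.2 ^ 2 * |a + p.2 * p.1| ≤ 1} ≤ ENNReal.ofReal 1 := by
  have hm : MeasurableSet {p : ℝ × ℝ | 1 < p.2 ∧ p.2 ^ 2 * |a + p.2 * p.1| ≤ 1} :=
    (measurableSet_lt (f := fun _ ↦ (1 : ℝ)) (g := Prod.snd) (by fun_prop) (by fun_prop)).inter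
      (measurableSet_le (f := fun p : ℝ × ℝ ↦ p.2 ^ 2 * |a + p.2 * p.1|) (by fun_prop)
        (measurable_const (a := 1)))
  have hslice (y : ℝ) : volume ((fun x ↦ (x, y)) ⁻¹'
      {p : ℝ × ℝ | 1 < p.2 ∧ p.2 ^ 2 * |a + p.2 * p.1| ≤ 1}) ≤
      (Set.Ioi (1 : ℝ)).indicator (fun y ↦ ENNReal.ofReal (2 * y ^ (-3 : ℝ))) y := by
    by_cases hy : 1 < y
    · have hy0 : 0 < y := by linarith
      rw [Set.indicator_of_mem (Set.mem_Ioi.2 hy)]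
      have hsub : (fun x ↦ (x, y)) ⁻¹' {p : ℝ × ℝ | 1 < p.2 ∧ p.2 ^ 2 * |a + p.2 * p.1| ≤ 1} ⊆
          Metric.closedBall (-a / y) (y ^ (-3 : ℝ)) := by
        rintro x ⟨-, hx⟩
        have h3 : y ^ (-3 : ℝ) = 1 / y ^ 3 := by
          rw [rpow_neg hy0.le, one_div]
          norm_cast
        have hxy : a + y * x = y * (x - -a / y) := by
          field_simp
          ring
        simp only [hxy, abs_mul, abs_of_pos hy0] at hx
        rw [Metric.mem_closedBall, Real.dist_eq, h3, le_div_iff₀ (by positivity)]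
        linarith
      calc _ ≤ _ := measure_mono hsub
        _ = _ := Real.volume_closedBall _ _
    · have hempty : (fun x ↦ (x, y)) ⁻¹'
          {p : ℝ × ℝ | 1 < p.2 ∧ p.2 ^ 2 * |a + p.2 * p.1| ≤ 1} = ∅ := by
        ext x
        simp [hy]
      simp [hempty]
  rw [Measure.volume_eq_prod, Measure.prod_apply_symm hm]
  refine (lintegral_mono hslice).trans_eq ?_
  rw [lintegral_indicator measurableSet_Ioi, ← ofReal_integral_eq_lintegral_ofReal
    ((integrableOn_Ioi_rpow_of_lt (by norm_num) one_pos).const_mul 2), integral_const_mul,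
    integral_Ioi_rpow_of_lt (by norm_num) one_pos]
  · norm_num
  · filter_upwards [ae_restrict_mem measurableSet_Ioi] with y hy
    have hy0 : 0 < y := one_pos.trans hy
    simp only [Pi.zero_apply]
    positivity

lemma Dh_subset (t7 : ℝ) : Dh t7 ⊆ Set.Icc (-1) 1 ×ˢ Set.Icc 0 1 ∪
    {p : ℝ × ℝ | 1 < p.2 ∧ p.2 ^ 2 * |t7 ^ 2 + p.2 * p.1| ≤ 1} := by
  rintro ⟨x, y⟩ ⟨hy, h⟩
  simp only [hfun, max_le_iff] at h hy
  rcases le_or_gt y 1 with hy1 | hy1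
  · exact Or.inl ⟨abs_le.1 h.2.1, hy.le, hy1⟩
  · exact Or.inr ⟨hy1, h.1.1⟩

/-- Bounds for the slices of the region `h ≤ 1`: the `t8`-slice has measure
at most `2/(t6 t7)`, and `D_h(t7)` has uniformly bounded area. -/
theorem slice_bounds :
    (∀ t6 t7 : ℝ, 0 < t6 → 0 < t7 →
      volume {t8 : ℝ | hfun t8 t6 t7 ≤ 1} ≤ ENNReal.ofReal (2 / (t6 * t7))) ∧
    ∃ C : ℝ, ∀ t7 : ℝ, 0 < t7 → volume (Dh t7) ≤ ENNReal.ofReal C := by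
  refine ⟨fun t6 t7 h6 h7 ↦ ?_, 3, fun t7 _ ↦ ?_⟩
  · have hsub : {t8 : ℝ | hfun t8 t6 t7 ≤ 1} ⊆ Metric.closedBall 0 (1 / (t6 * t7)) := by
      intro x hx
      simp only [Set.mem_ofPred_eq, hfun, max_le_iff] at hx
      rw [mem_closedBall_zero_iff, Real.norm_eq_abs, le_div_iff₀ (by positivity)]
      linarith [hx.2.2]
    refine (measure_mono hsub).trans_eq ?_
    rw [Real.volume_closedBall]
    congr 1
    ring
  · have hbox : volume (Set.Icc (-1 : ℝ) 1 ×ˢ Set.Icc (0 : ℝ) 1) = ENNReal.ofReal 2 := by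
      rw [Measure.volume_eq_prod, Measure.prod_prod, Real.volume_Icc, Real.volume_Icc]
      norm_num
    calc volume (Dh t7) ≤ _ := measure_mono (Dh_subset t7)
      _ ≤ _ := measure_union_le _ _
      _ ≤ ENNReal.ofReal 2 + ENNReal.ofReal 1 := add_le_add hbox.le (volume_one_lt_le _)
      _ = ENNReal.ofReal 3 := by rw [← ENNReal.ofReal_add] <;> norm_num

end
end

section
/- Set D_h(t7) = { (t8, t6) ∈ ℝ² : t6 > 0, h(t8, t6, t7) ≤ 1 }. There is an absolute constant C such that for all t7 > 0 and all Z6, Z8 > 0: (i) the Lebesgue measure of { (t8, t6) ∈ D_h(t7) : t6·Z6 ≥ 1 } is at most C·Z6; (ii) the Lebesgue measure of { (t8, t6) ∈ D_h(t7) : t6·Z6 < 1 } is at most C·Z6^{−1}; (iii) the Lebesgue measure of { (t8, t6) ∈ D_h(t7) : |t8|·Z8 < 1 } is at most C·Z8^{−2/3}. -/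
open MeasureTheory Real

noncomputable section

lemma measurableSet_Dh (t7 : ℝ) : MeasurableSet (Dh t7) := by
  have h : Measurable fun p : ℝ × ℝ => hfun p.1 p.2 t7 := by
    unfold hfun
    fun_prop
  exact (measurableSet_lt measurable_const measurable_snd).inter
    (measurableSet_le h measurable_const)

/-- A planar set whose horizontal slices at height `t ≥ T` lie in intervals of radius `t ^ a`,
where `a < -1`, and which has no points below height `T`, has area at most
`2 * T ^ (a + 1) / (-(a + 1))`. -/
lemma volume_le_of_slices_rpow {S : Set (ℝ × ℝ)} (hS : MeasurableSet S) {T a : ℝ} (hT : 0 < T)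
    (ha : a < -1) (hST : ∀ p ∈ S, T ≤ p.2)
    (hslice : ∀ t, T ≤ t → ∃ c, ∀ x, (x, t) ∈ S → |x - c| ≤ t ^ a) :
    volume S ≤ ENNReal.ofReal (2 * (-T ^ (a + 1) / (a + 1))) := by
  rw [Measure.volume_eq_prod, Measure.prod_apply_symm hS]
  calc ∫⁻ t, volume ((fun x => (x, t)) ⁻¹' S)
      ≤ ∫⁻ t, (Set.Ici T).indicator (fun t => ENNReal.ofReal (2 * t ^ a)) t := by
        refine lintegral_mono fun t => ?_
        by_cases ht : T ≤ t
        · obtain ⟨c, hc⟩ := hslice t ht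
          rw [Set.indicator_of_mem (Set.mem_Ici.2 ht), ← Real.volume_closedBall]
          exact measure_mono fun x hx => by
            simpa [Real.dist_eq] using hc x hx
        · have : (fun x : ℝ => (x, t)) ⁻¹' S = ∅ :=
            Set.eq_empty_of_forall_notMem fun x hx => ht (hST _ hx)
          simp [this]
    _ = ∫⁻ t in Set.Ioi T, ENNReal.ofReal (2 * t ^ a) := by
        rw [lintegral_indicator measurableSet_Ici, setLIntegral_congr Ioi_ae_eq_Ici.symm]
    _ = ENNReal.ofReal (2 * (-T ^ (a + 1) / (a + 1))) := by
        rw [← integral_Ioi_rpow_of_lt ha hT, ← integral_const_mul,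
          ofReal_integral_eq_lintegral_ofReal]
        · exact (integrableOn_Ioi_rpow_of_lt ha hT).const_mul 2
        · filter_upwards [ae_restrict_mem measurableSet_Ioi] with t ht
          have : 0 < t := hT.trans ht
          simp only [Pi.zero_apply]
          positivity

/-- A planar set contained in `[-w, w] × [0, T]` has area at most `2 * w * T`. -/
lemma volume_le_of_subset_box {S : Set (ℝ × ℝ)} {w T : ℝ} (hw : 0 ≤ w)
    (hS : ∀ p ∈ S, |p.1| ≤ w ∧ 0 ≤ p.2 ∧ p.2 ≤ T) :
    volume S ≤ ENNReal.ofReal (2 * w * T) := by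
  calc volume S ≤ volume (Metric.closedBall (0 : ℝ) w ×ˢ Set.Icc 0 T) :=
        measure_mono fun p hp => by
          simpa [Real.dist_eq] using hS p hp
    _ = ENNReal.ofReal (2 * w * T) := by
        rw [Measure.volume_eq_prod, Measure.prod_prod, Real.volume_closedBall, Real.volume_Icc,
          sub_zero, ← ENNReal.ofReal_mul (by positivity)]

lemma abs_fst_le_one_of_mem_Dh {t7 : ℝ} {p : ℝ × ℝ} (hp : p ∈ Dh t7) : |p.1| ≤ 1 :=
  (le_max_left _ _).trans ((le_max_right _ _).trans hp.2)

/-- Slices of `D_h(t7)` at height `t` lie in an interval of radius `t ^ (-3)`. -/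
lemma abs_sub_le_rpow_of_mem_Dh {t7 x t : ℝ} (hp : (x, t) ∈ Dh t7) :
    |x - -(t7 ^ 2 / t)| ≤ t ^ (-3 : ℝ) := by
  have ht : 0 < t := hp.1
  have h1 : t ^ 2 * |t7 ^ 2 + t * x| ≤ 1 :=
    (le_max_left _ _).trans ((le_max_left _ _).trans hp.2)
  have h2 : t7 ^ 2 + t * x = t * (x - -(t7 ^ 2 / t)) := by field_simp; ring
  rw [h2, abs_mul, abs_of_pos ht] at h1
  rw [show (-3 : ℝ) = -((3 : ℕ) : ℝ) by norm_num, rpow_neg ht.le, rpow_natCast,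
    ← one_div, le_div_iff₀ (by positivity)]
  linarith

/-- Measure bounds for subregions of `D_h(t7)`. -/
theorem Dh_subregion_bounds :
    ∃ C : ℝ, ∀ t7 Z6 Z8 : ℝ, 0 < t7 → 0 < Z6 → 0 < Z8 →
      volume {p ∈ Dh t7 | 1 ≤ p.2 * Z6} ≤ ENNReal.ofReal (C * Z6) ∧
      volume {p ∈ Dh t7 | p.2 * Z6 < 1} ≤ ENNReal.ofReal (C * Z6⁻¹) ∧
      volume {p ∈ Dh t7 | |p.1| * Z8 < 1} ≤ ENNReal.ofReal (C * Z8 ^ (-(2 : ℝ) / 3)) := by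
  refine ⟨3, fun t7 Z6 Z8 _ h6 h8 => ⟨?_, ?_, ?_⟩⟩
  · refine (volume_le_of_slices_rpow (T := Z6⁻¹) (a := -2)
      ((measurableSet_Dh t7).inter (measurableSet_le measurable_const (measurable_snd.mul_const Z6)))
      (by positivity) (by norm_num) (fun p hp => ?_) (fun t ht => ?_)).trans
      (ENNReal.ofReal_le_ofReal ?_)
    · rw [inv_le_iff_one_le_mul₀ h6]
      exact hp.2
    · have ht0 : 0 < t := (inv_pos.2 h6).trans_le ht
      rcases le_total 1 t with h | h
      · exact ⟨_, fun x hx => (abs_sub_le_rpow_of_mem_Dh hx.1).trans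
          (rpow_le_rpow_of_exponent_le h (by norm_num))⟩
      · refine ⟨0, fun x hx => ?_⟩
        rw [sub_zero]
        exact (abs_fst_le_one_of_mem_Dh hx.1).trans
          (one_le_rpow_of_pos_of_le_one_of_nonpos ht0 h (by norm_num))
    · rw [show (-2 : ℝ) + 1 = -1 by norm_num, rpow_neg_one, inv_inv]
      linarith
  · refine (volume_le_of_subset_box (w := 1) (T := Z6⁻¹) zero_le_one fun p hp =>
      ⟨abs_fst_le_one_of_mem_Dh hp.1, hp.1.1.le, ?_⟩).trans (ENNReal.ofReal_le_ofReal ?_)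
    · rw [← one_div, le_div_iff₀ h6]
      exact hp.2.le
    · have : 0 < Z6⁻¹ := inv_pos.2 h6
      linarith
  · set T : ℝ := Z8 ^ (1 / 3 : ℝ) with hTdef
    have hT : 0 < T := rpow_pos_of_pos h8 _
    set S : Set (ℝ × ℝ) := {p ∈ Dh t7 | |p.1| * Z8 < 1}
    have hS : MeasurableSet S :=
      (measurableSet_Dh t7).inter (measurableSet_lt
        ((measurable_fst.abs).mul_const Z8) measurable_const)
    have low : volume (S ∩ {p | p.2 ≤ T}) ≤ ENNReal.ofReal (2 * Z8⁻¹ * T) := by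
      refine volume_le_of_subset_box (by positivity) fun p hp => ⟨?_, hp.1.1.1.le, hp.2⟩
      rw [← one_div, le_div_iff₀ h8]
      exact hp.1.2.le
    have high : volume (S ∩ {p | T ≤ p.2}) ≤
        ENNReal.ofReal (2 * (-T ^ ((-3 : ℝ) + 1) / (-3 + 1))) :=
      volume_le_of_slices_rpow (hS.inter (measurableSet_le measurable_const measurable_snd)) hT
        (by norm_num) (fun p hp => hp.2)
        fun t _ => ⟨_, fun x hx => abs_sub_le_rpow_of_mem_Dh hx.1.1⟩
    have e1 : Z8⁻¹ * T = Z8 ^ (-(2 : ℝ) / 3) := by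
      rw [← rpow_neg_one, hTdef, ← rpow_add h8]
      norm_num
    have e2 : 2 * (-T ^ ((-3 : ℝ) + 1) / (-3 + 1)) = Z8 ^ (-(2 : ℝ) / 3) := by
      rw [hTdef, ← rpow_mul h8.le]
      norm_num
      ring
    rw [mul_assoc, e1] at low
    rw [e2] at high
    have hpos : 0 < Z8 ^ (-(2 : ℝ) / 3) := rpow_pos_of_pos h8 _
    calc volume S ≤ volume (S ∩ {p | p.2 ≤ T} ∪ S ∩ {p | T ≤ p.2}) :=
          measure_mono fun p hp => (le_total p.2 T).imp (⟨hp, ·⟩) (⟨hp, ·⟩)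
      _ ≤ _ := (measure_union_le _ _).trans (add_le_add low high)
      _ = ENNReal.ofReal (3 * Z8 ^ (-(2 : ℝ) / 3)) := by
          rw [← ENNReal.ofReal_add (by positivity) hpos.le]
          congr 1
          ring

end
end

section
/- Set D_h = { (t8, t6, t7) ∈ ℝ³ : t6 > 0, t7 > 0, h(t8, t6, t7) ≤ 1 }. There is an absolute constant C such that for all t > 0: (i) the three-dimensional Lebesgue measure of { (t8, t6, t7) ∈ D_h : t ≤ |t6·t8 + t7²| } is at most C·t^{−1/2}; (ii) the three-dimensional Lebesgue measure of { (t8, t6, t7) ∈ D_h : t > |t6·t8 + t7²| } is at most C·t^{1/2}. -/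
open MeasureTheory Real

noncomputable section

/-- The region `D_h ⊂ ℝ³`, coordinates `(t8, t6, t7)`. -/
def DhFull : Set (ℝ × ℝ × ℝ) :=
  {p | 0 < p.2.1 ∧ 0 < p.2.2 ∧ hfun p.1 p.2.1 p.2.2 ≤ 1}

theorem measurable_hfun : Measurable fun p : ℝ × ℝ × ℝ => hfun p.1 p.2.1 p.2.2 := by
  unfold hfun
  fun_prop

theorem measurableSet_DhFull : MeasurableSet DhFull := by
  have hu : MeasurableSet {p : ℝ × ℝ × ℝ | 0 < p.2.1} :=
    measurableSet_lt measurable_const (by fun_prop)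
  have hv : MeasurableSet {p : ℝ × ℝ × ℝ | 0 < p.2.2} :=
    measurableSet_lt measurable_const (by fun_prop)
  exact hu.inter (hv.inter (measurableSet_le measurable_hfun measurable_const))

/-- Majorant, as a function of `u = t6`, for the length of the `t8`-slices of the region
`|t6 t8 + t7²| < t`, up to the factor `2 √t`. -/
def sliceMajorant (u : ℝ) : ENNReal :=
  (Set.Ioc (0 : ℝ) 1).indicator (fun u => ENNReal.ofReal (u ^ (-(1 : ℝ) / 2))) u +
    (Set.Ioi (1 : ℝ)).indicator (fun u => ENNReal.ofReal (u ^ (-2 : ℝ))) u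

theorem measurable_sliceMajorant : Measurable sliceMajorant :=
  (Measurable.indicator (by fun_prop) measurableSet_Ioc).add
    (Measurable.indicator (by fun_prop) measurableSet_Ioi)

theorem lintegral_sliceMajorant : ∫⁻ u, sliceMajorant u = 3 := by
  unfold sliceMajorant
  rw [lintegral_add_left (Measurable.indicator (by fun_prop) measurableSet_Ioc),
    lintegral_indicator measurableSet_Ioc, lintegral_indicator measurableSet_Ioi,
    ← ofReal_integral_eq_lintegral_ofReal, ← ofReal_integral_eq_lintegral_ofReal,
    integral_Ioi_rpow_of_lt (by norm_num) one_pos,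
    ← intervalIntegral.integral_of_le zero_le_one, integral_rpow (by norm_num),
    ← ENNReal.ofReal_add (by norm_num) (by norm_num)]
  · norm_num
  · exact integrableOn_Ioi_rpow_of_lt (by norm_num) one_pos
  · filter_upwards [ae_restrict_mem measurableSet_Ioi] with u hu
    exact rpow_nonneg (zero_le_one.trans (le_of_lt hu)) _
  · exact (intervalIntegrable_iff_integrableOn_Ioc_of_le zero_le_one).1
      (intervalIntegral.intervalIntegrable_rpow' (by norm_num))
  · filter_upwards [ae_restrict_mem measurableSet_Ioc] with u hu
    exact rpow_nonneg hu.1.le _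

theorem volume_abs_mul_add_le {u : ℝ} (hu : 0 < u) (c m : ℝ) :
    volume {s : ℝ | |u * s + c| ≤ m} ≤ ENNReal.ofReal (2 * m / u) := by
  have hsub : {s : ℝ | |u * s + c| ≤ m} ⊆ Set.Icc ((-m - c) / u) ((m - c) / u) := by
    intro s hs
    have hs' := abs_le.1 (Set.mem_ofPred_eq ▸ hs)
    constructor
    · rw [div_le_iff₀ hu]
      linarith
    · rw [le_div_iff₀ hu]
      linarith
  refine (measure_mono hsub).trans_eq ?_
  rw [Real.volume_Icc]
  congr 1
  ring

theorem volume_slice_le {t : ℝ} (ht : 0 < t) (u v : ℝ) :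
    volume {s : ℝ | (s, u, v) ∈ DhFull ∧ |u * s + v ^ 2| < t} ≤
      (ENNReal.ofReal (2 * √t) * sliceMajorant u) * (Set.Ioc (0 : ℝ) 1).indicator 1 v := by
  by_cases h : 0 < u ∧ v ∈ Set.Ioc (0 : ℝ) 1
  swap
  · have hempty : {s : ℝ | (s, u, v) ∈ DhFull ∧ |u * s + v ^ 2| < t} = ∅ := by
      refine Set.eq_empty_of_forall_notMem fun s hs => h ?_
      obtain ⟨⟨hu, hv, hh⟩, -⟩ := hs
      simp only [hfun, max_le_iff] at hh
      exact ⟨hu, hv, hh.1.2⟩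
    simp [hempty]
  obtain ⟨hu, hv⟩ := h
  rw [Set.indicator_of_mem hv, Pi.one_apply, mul_one]
  have hst : √t * √t = t := mul_self_sqrt ht.le
  have hst0 : 0 < √t := sqrt_pos.2 ht
  rcases le_or_gt u 1 with hu1 | hu1
  · have hmaj : sliceMajorant u = ENNReal.ofReal (u ^ (-(1 : ℝ) / 2)) := by
      simp [sliceMajorant, hu, hu1]
    have hpow : u ^ (-(1 : ℝ) / 2) = (√u)⁻¹ := by
      rw [neg_div, rpow_neg hu.le, ← sqrt_eq_rpow]
    rw [hmaj, hpow, ← ENNReal.ofReal_mul (by positivity)]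
    have hsu : √u * √u = u := mul_self_sqrt hu.le
    have hsu0 : 0 < √u := sqrt_pos.2 hu
    rcases le_total u t with hut | hut
    · have hsub : {s : ℝ | (s, u, v) ∈ DhFull ∧ |u * s + v ^ 2| < t} ⊆ Set.Icc (-1) 1 := by
        rintro s ⟨⟨-, -, hh⟩, -⟩
        simp only [hfun, max_le_iff] at hh
        exact abs_le.1 hh.2.1
      refine (measure_mono hsub).trans ?_
      rw [Real.volume_Icc]
      apply ENNReal.ofReal_le_ofReal
      rw [← div_eq_mul_inv, le_div_iff₀ hsu0]
      linarith [sqrt_le_sqrt hut]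
    · have hsub : {s : ℝ | (s, u, v) ∈ DhFull ∧ |u * s + v ^ 2| < t} ⊆
          {s : ℝ | |u * s + v ^ 2| ≤ t} := fun s hs => hs.2.le
      refine (measure_mono hsub).trans ((volume_abs_mul_add_le hu _ _).trans ?_)
      apply ENNReal.ofReal_le_ofReal
      rw [← div_eq_mul_inv, div_le_div_iff₀ hu hsu0]
      have := sqrt_le_sqrt hut
      calc 2 * t * √u = 2 * √t * √u * √t := by linear_combination (-2 * √u) * hst
        _ ≤ 2 * √t * √u * √u := by gcongr
        _ = 2 * √t * u := by linear_combination (2 * √t) * hsu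
  · have hmaj : sliceMajorant u = ENNReal.ofReal (u ^ (-2 : ℝ)) := by
      simp [sliceMajorant, hu1]
    have hpow : u ^ (-2 : ℝ) = (u ^ 2)⁻¹ := by
      rw [rpow_neg hu.le]
      norm_cast
    have hsub : {s : ℝ | (s, u, v) ∈ DhFull ∧ |u * s + v ^ 2| < t} ⊆
        {s : ℝ | |u * s + v ^ 2| ≤ √t / u} := by
      rintro s ⟨⟨-, -, hh⟩, hs⟩
      simp only [hfun, max_le_iff] at hh
      have hF := hh.1.1
      rw [add_comm (v ^ 2)] at hF
      rw [Set.mem_ofPred_eq, le_div_iff₀ hu]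
      apply le_sqrt_of_sq_le
      have h0 := abs_nonneg (u * s + v ^ 2)
      calc (|u * s + v ^ 2| * u) ^ 2
          = |u * s + v ^ 2| * (u ^ 2 * |u * s + v ^ 2|) := by ring
        _ ≤ |u * s + v ^ 2| * 1 := by gcongr
        _ ≤ t := by linarith
    rw [hmaj, hpow, ← ENNReal.ofReal_mul (by positivity)]
    refine (measure_mono hsub).trans ((volume_abs_mul_add_le hu _ _).trans_eq ?_)
    congr 1
    field_simp

theorem volume_DhFull_abs_lt_le {t : ℝ} (ht : 0 < t) :
    volume {p ∈ DhFull | |p.2.1 * p.1 + p.2.2 ^ 2| < t} ≤ ENNReal.ofReal (6 * √t) := by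
  have hmeas : MeasurableSet {p ∈ DhFull | |p.2.1 * p.1 + p.2.2 ^ 2| < t} := by
    have hlt : MeasurableSet {p : ℝ × ℝ × ℝ | |p.2.1 * p.1 + p.2.2 ^ 2| < t} :=
      measurableSet_lt (by fun_prop) measurable_const
    exact measurableSet_DhFull.inter hlt
  rw [Measure.volume_eq_prod, Measure.prod_apply_symm hmeas]
  refine (lintegral_mono fun q : ℝ × ℝ => volume_slice_le ht q.1 q.2).trans_eq ?_
  rw [Measure.volume_eq_prod, lintegral_prod_mul
      (f := fun u => ENNReal.ofReal (2 * √t) * sliceMajorant u)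
      (measurable_sliceMajorant.const_mul _).aemeasurable
      (measurable_one.indicator measurableSet_Ioc).aemeasurable,
    lintegral_const_mul _ measurable_sliceMajorant, lintegral_sliceMajorant,
    lintegral_indicator_one measurableSet_Ioc, Real.volume_Ioc, sub_zero,
    ENNReal.ofReal_one, mul_one, ← ENNReal.ofReal_ofNat 3, ← ENNReal.ofReal_mul (by positivity)]
  congr 1
  ring

theorem volume_DhFull_le_abs_le {t : ℝ} (ht : 0 < t) :
    volume {p ∈ DhFull | t ≤ |p.2.1 * p.1 + p.2.2 ^ 2|} ≤ ENNReal.ofReal (2 * (√t)⁻¹) := by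
  have hst0 : 0 < √t := sqrt_pos.2 ht
  have hsub : {p ∈ DhFull | t ≤ |p.2.1 * p.1 + p.2.2 ^ 2|} ⊆
      Set.Icc (-1) 1 ×ˢ Set.Icc 0 (√t)⁻¹ ×ˢ Set.Icc 0 1 := by
    rintro ⟨s, u, v⟩ ⟨⟨hu, hv, hh⟩, hF⟩
    simp only [hfun, max_le_iff] at hu hv hh hF
    obtain ⟨⟨hu2, hv1⟩, hs1, -⟩ := hh
    refine ⟨abs_le.1 hs1, ⟨hu.le, ?_⟩, hv.le, hv1⟩
    change u ≤ (√t)⁻¹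
    rw [← one_div, le_div_iff₀ hst0]
    refine abs_le_of_sq_le_sq' ?_ zero_le_one |>.2
    rw [add_comm (v ^ 2)] at hu2
    calc (u * √t) ^ 2 = u ^ 2 * t := by rw [mul_pow, sq_sqrt ht.le]
      _ ≤ u ^ 2 * |u * s + v ^ 2| := by gcongr
      _ ≤ 1 ^ 2 := by linarith
  refine (measure_mono hsub).trans_eq ?_
  rw [Measure.volume_eq_prod, Measure.prod_prod, Measure.volume_eq_prod, Measure.prod_prod,
    Real.volume_Icc, Real.volume_Icc, Real.volume_Icc, sub_zero, sub_zero, ← ENNReal.ofReal_mul (by positivity),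
    ← ENNReal.ofReal_mul (by norm_num)]
  congr 1
  ring

/-- Measure bounds for the subregions of `D_h` cut out by `t ≤ |t6 t8 + t7²|`
and its complement. -/
theorem DhFull_cut_bounds :
    ∃ C : ℝ, ∀ t : ℝ, 0 < t →
      volume {p ∈ DhFull | t ≤ |p.2.1 * p.1 + p.2.2 ^ 2|} ≤
        ENNReal.ofReal (C * t ^ (-(1 : ℝ) / 2)) ∧
      volume {p ∈ DhFull | |p.2.1 * p.1 + p.2.2 ^ 2| < t} ≤
        ENNReal.ofReal (C * t ^ ((1 : ℝ) / 2)) := by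
  refine ⟨6, fun t ht => ⟨?_, ?_⟩⟩
  · rw [neg_div, rpow_neg ht.le, ← sqrt_eq_rpow]
    refine (volume_DhFull_le_abs_le ht).trans (ENNReal.ofReal_le_ofReal ?_)
    gcongr
    norm_num
  · rw [← sqrt_eq_rpow]
    exact volume_DhFull_abs_lt_le ht

end
end
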